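/- Let Γ be a countable discrete group, let A and B be separable unital C*-algebras, and let α: Γ → Aut(A) and β: Γ → Aut(B) be actions. Let (φ, v): (A, α) → (B, β) and (ψ, w): (B, β) → (A, α) be cocycle morphisms such that (ψ, w) ∘ (φ, v) is asymptotically unitarily equivalent to the identity cocycle morphism on (A, α) and (φ, v) ∘ (ψ, w) is asymptotically unitarily equivalent to the identity cocycle morphism on (B, β). Then there exists a cocycle conjugacy (Φ, V): (A, α) → (B, β) such that (Φ, V) is asymptotically unitarily equivalent to (φ, v) and the inverse cocycle conjugacy (Φ⁻¹, g ↦ Φ⁻¹(V_g)*) is asymptotically unitarily equivalent to (ψ, w). -/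

import Mathlib

open Filter Topology

/-- `α : Γ → Aut(A)` is an action of the group `Γ` on the unital C⋆-algebra `A` by
⋆-automorphisms. -/
def IsCStarAction {Γ A : Type*} [Group Γ] [CStarAlgebra A] (α : Γ → A ≃⋆ₐ[ℂ] A) : Prop :=
  (∀ a : A, α 1 a = a) ∧ ∀ g h : Γ, ∀ a : A, α (g * h) a = α g (α h a)

/-- The cocycle conditions for a pair `(φ, v)`. -/
def IsCocyclePair {Γ A B : Type*} [Group Γ] [CStarAlgebra A] [CStarAlgebra B]
    (α : Γ → A ≃⋆ₐ[ℂ] A) (β : Γ → B ≃⋆ₐ[ℂ] B) (φ : A → B) (v : Γ → unitary B) : Prop :=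
  v 1 = 1 ∧
  (∀ (g : Γ) (a : A), β g (φ a) * (v g : B) = (v g : B) * φ (α g a)) ∧
  (∀ g h : Γ, (v (g * h) : B) = β g (v h) * (v g : B))

/-- Asymptotic unitary equivalence of (formal) cocycle morphisms `(φ, v)` and `(ψ, w)` from
`(A, α)` to `(B, β)`: there is a norm-continuous path `u : [0,∞) → U(B)` with
`‖β g (u t) * v g * φ a * (u t)⋆  -  w g * ψ a‖ → 0` as `t → ∞` for all `g` and `a`. -/
def CocycleAsympUnitaryEquiv {Γ A B : Type*} [Group Γ] [CStarAlgebra A] [CStarAlgebra B]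
    (β : Γ → B ≃⋆ₐ[ℂ] B) (φ ψ : A → B) (v w : Γ → B) : Prop :=
  ∃ u : ℝ → unitary B,
    ContinuousOn (fun t => (u t : B)) (Set.Ici (0 : ℝ)) ∧
    ∀ (g : Γ) (a : A),
      Tendsto (fun t => ‖β g (u t) * v g * φ a * star ((u t : B)) - w g * ψ a‖) atTop (𝓝 (0 : ℝ))

section UnitaryConjugation

variable {ι A B : Type*} [CStarAlgebra A] [CStarAlgebra B] {l : Filter ι}

theorem norm_unitary_mul_mul_unitary {p q : B} (hp : p ∈ unitary B) (hq : q ∈ unitary B) (x : B) :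
    ‖p * x * q‖ = ‖x‖ := by
  rw [CStarRing.norm_mul_mem_unitary _ hq, CStarRing.norm_mem_unitary_mul _ hp]

theorem star_mul_cancel_left_of_mem_unitary {p : B} (hp : p ∈ unitary B) (x : B) :
    star p * (p * x) = x := by
  rw [← mul_assoc, Unitary.star_mul_self_of_mem hp, one_mul]

theorem mul_star_cancel_left_of_mem_unitary {p : B} (hp : p ∈ unitary B) (x : B) :
    p * (star p * x) = x := by
  rw [← mul_assoc, Unitary.mul_star_self_of_mem hp, one_mul]

theorem coe_star_mul_cancel_left (p : unitary B) (x : B) :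
    star (p : B) * ((p : B) * x) = x :=
  star_mul_cancel_left_of_mem_unitary p.2 x

theorem coe_mul_star_cancel_left (p : unitary B) (x : B) :
    (p : B) * (star (p : B) * x) = x :=
  mul_star_cancel_left_of_mem_unitary p.2 x

theorem NonUnitalStarAlgHom.continuous_of_cstarAlgebra (φ : A →⋆ₙₐ[ℂ] B) : Continuous φ :=
  AddMonoidHomClass.continuous_of_bound φ 1 fun a => by
    simpa using NonUnitalStarAlgHom.norm_apply_le φ a

theorem StarAlgHom.norm_apply_le_of_cstarAlgebra (φ : A →⋆ₐ[ℂ] B) (a : A) : ‖φ a‖ ≤ ‖a‖ :=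
  NonUnitalStarAlgHom.norm_apply_le φ.toNonUnitalStarAlgHom a

theorem StarAlgHom.continuous_of_cstarAlgebra (φ : A →⋆ₐ[ℂ] B) : Continuous φ :=
  φ.toNonUnitalStarAlgHom.continuous_of_cstarAlgebra

theorem StarAlgEquiv.continuous_of_cstarAlgebra (σ : A ≃⋆ₐ[ℂ] B) : Continuous σ :=
  AddMonoidHomClass.continuous_of_bound σ 1 fun a => by
    simpa using NonUnitalStarAlgHom.norm_apply_le σ a

/-- If `p x q → y` with `p, q` unitary and `x` constant, then `p⋆ y q⋆ → x`. -/
theorem tendsto_star_mul_mul_star {p q : ι → B} (hp : ∀ t, p t ∈ unitary B)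
    (hq : ∀ t, q t ∈ unitary B) {x y : B} (h : Tendsto (fun t => p t * x * q t) l (𝓝 y)) :
    Tendsto (fun t => star (p t) * y * star (q t)) l (𝓝 x) := by
  rw [tendsto_iff_norm_sub_tendsto_zero] at h ⊢
  refine h.congr fun t => ?_
  rw [← norm_unitary_mul_mul_unitary (hp t) (hq t) (star (p t) * y * star (q t) - x),
    norm_sub_rev]
  congr 1
  simp only [mul_sub, sub_mul, mul_assoc, mul_star_cancel_left_of_mem_unitary (hp t),
    Unitary.star_mul_self_of_mem (hq t), mul_one]

/-- If `f → x` and `p x q → y` with `p, q` unitary, then `p f q → y`. -/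
theorem tendsto_unitary_mul_mul_unitary {p q : ι → B} (hp : ∀ t, p t ∈ unitary B)
    (hq : ∀ t, q t ∈ unitary B) {f : ι → B} {x y : B} (hf : Tendsto f l (𝓝 x))
    (h : Tendsto (fun t => p t * x * q t) l (𝓝 y)) :
    Tendsto (fun t => p t * f t * q t) l (𝓝 y) := by
  have h0 : Tendsto (fun t => p t * (f t - x) * q t) l (𝓝 0) := by
    rw [tendsto_zero_iff_norm_tendsto_zero]
    simp only [norm_unitary_mul_mul_unitary (hp _) (hq _)]
    exact tendsto_iff_norm_sub_tendsto_zero.1 hf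
  have h1 := h0.add h
  rw [zero_add] at h1
  refine h1.congr fun t => ?_
  simp only [mul_sub, sub_mul, sub_add_cancel]

end UnitaryConjugation

section PathCharacterisation

variable {Γ A B : Type*} [Group Γ] [CStarAlgebra A] [CStarAlgebra B]

theorem CocycleAsympUnitaryEquiv.exists_path {β : Γ → B ≃⋆ₐ[ℂ] B} (hβ : IsCStarAction β)
    {φ φ' : A → B} {v v' : Γ → B} (h : CocycleAsympUnitaryEquiv β φ φ' v v')
    (hv : v 1 = 1) (hv' : v' 1 = 1) (hφ : φ 1 = 1) (hφ' : φ' 1 = 1) :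
    ∃ u : ℝ → unitary B, ContinuousOn u (Set.Ici (0 : ℝ)) ∧
      (∀ a, Tendsto (fun t => (u t : B) * φ a * star (u t : B)) atTop (𝓝 (φ' a))) ∧
      ∀ g, Tendsto (fun t => β g (u t) * v g * star (u t : B)) atTop (𝓝 (v' g)) := by
  obtain ⟨u, hu, h⟩ := h
  refine ⟨u, ?_, fun a => ?_, fun g => ?_⟩
  · exact Topology.IsInducing.subtypeVal.continuousOn_iff.2 hu
  · rw [tendsto_iff_norm_sub_tendsto_zero]
    simpa [hv, hv', hβ.1] using h 1 a
  · rw [tendsto_iff_norm_sub_tendsto_zero]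
    simpa [hφ, hφ'] using h g 1

theorem CocycleAsympUnitaryEquiv.of_path {β : Γ → B ≃⋆ₐ[ℂ] B} {φ φ' : A → B} {v v' : Γ → B}
    (u : ℝ → unitary B) (hu : ContinuousOn u (Set.Ici (0 : ℝ)))
    (h : ∀ a, Tendsto (fun t => (u t : B) * φ a * star (u t : B)) atTop (𝓝 (φ' a)))
    (h' : ∀ g, Tendsto (fun t => β g (u t) * v g * star (u t : B)) atTop (𝓝 (v' g))) :
    CocycleAsympUnitaryEquiv β φ φ' v v' := by
  refine ⟨u, continuous_subtype_val.comp_continuousOn hu, fun g a => ?_⟩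
  refine tendsto_iff_norm_sub_tendsto_zero.1 (((h' g).mul (h a)).congr fun t => ?_)
  simp only [mul_assoc, coe_star_mul_cancel_left]

end PathCharacterisation

theorem exists_tendsto_of_norm_sub_le_geometric {E : Type*} [NormedAddCommGroup E]
    [CompleteSpace E] (f : ℝ → E) (m : ℕ)
    (hf : ∀ n : ℕ, m ≤ n → ∀ t ∈ Set.Icc (n : ℝ) (n + 1), ‖f t - f n‖ ≤ 1 / 2 / 2 ^ n) :
    ∃ x, Tendsto f atTop (𝓝 x) ∧ ∀ n : ℕ, m ≤ n → ‖f n - x‖ ≤ 1 / 2 ^ n := by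
  have hstep : ∀ k : ℕ, dist (f ((m + k : ℕ) : ℝ)) (f ((m + (k + 1) : ℕ) : ℝ))
      ≤ 1 / 2 ^ m / 2 / 2 ^ k := fun k => by
    have := hf (m + k) (by omega) ((m + (k + 1) : ℕ) : ℝ)
      ⟨by push_cast; linarith, by push_cast; linarith⟩
    rw [dist_comm, dist_eq_norm]
    refine this.trans (le_of_eq ?_)
    rw [pow_add]
    field_simp
  obtain ⟨x, hx⟩ := cauchySeq_tendsto_of_complete (cauchySeq_of_le_geometric_two hstep)
  refine ⟨x, ?_, fun n hn => ?_⟩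
  · have hx' : Tendsto (fun n : ℕ => f n) atTop (𝓝 x) := by
      refine (tendsto_add_atTop_iff_nat m).1 (hx.congr fun k => ?_)
      rw [add_comm]
    have hfl : Tendsto (fun t : ℝ => ⌊t⌋₊) atTop atTop := tendsto_nat_floor_atTop
    have h0 : Tendsto (fun t : ℝ => f t - f ⌊t⌋₊) atTop (𝓝 0) := by
      refine squeeze_zero_norm' (a := fun t : ℝ => (1 / 2 : ℝ) * (1 / 2) ^ ⌊t⌋₊) ?_ ?_
      · filter_upwards [hfl.eventually_ge_atTop m, eventually_ge_atTop (0 : ℝ)] with t ht ht0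
        refine (hf _ ht t ⟨Nat.floor_le ht0, (Nat.lt_floor_add_one t).le⟩).trans (le_of_eq ?_)
        rw [one_div_pow]
        ring
      · have := (tendsto_pow_atTop_nhds_zero_of_lt_one (r := (1 / 2 : ℝ)) (by norm_num)
          (by norm_num)).comp hfl
        simpa using this.const_mul (1 / 2 : ℝ)
    simpa using h0.add (hx'.comp hfl)
  · obtain ⟨k, rfl⟩ := Nat.exists_eq_add_of_le hn
    rw [← dist_eq_norm]
    refine (dist_le_of_le_geometric_two_of_tendsto hstep hx k).trans (le_of_eq ?_)
    rw [pow_add]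
    field_simp

/-- A path of unitaries along which `Ad (d t)` asymptotically fixes a unital homomorphism `φ` and
its cocycle `v`, and asymptotically moves all of `B` into the range of `φ`. -/
structure IsIntertwiningPath {Γ A B : Type*} [CStarAlgebra A] [CStarAlgebra B]
    (β : Γ → B ≃⋆ₐ[ℂ] B) (φ : A →⋆ₐ[ℂ] B) (v : Γ → unitary B) (d : ℝ → unitary B) : Prop where
  continuousOn : ContinuousOn d (Set.Ici (0 : ℝ))
  tendsto_conj : ∀ a, Tendsto (fun t => (d t : B) * φ a * star (d t : B)) atTop (𝓝 (φ a))
  tendsto_cocycle : ∀ g, Tendsto (fun t => β g (d t) * v g * star (d t : B)) atTop (𝓝 (v g : B))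
  exists_approx : ∀ b, ∃ y : ℝ → A,
    Tendsto (fun t => star (d t : B) * b * d t - φ (y t)) atTop (𝓝 0)

namespace IsIntertwiningPath

variable {Γ A B : Type*} [CStarAlgebra A] [CStarAlgebra B]
  {β : Γ → B ≃⋆ₐ[ℂ] B} {φ : A →⋆ₐ[ℂ] B} {v : Γ → unitary B} {d : ℝ → unitary B}

theorem exists_segment (hd : IsIntertwiningPath β φ v d) {a : ℕ → A} (ha : DenseRange a)
    (b : ℕ → B) (γ : ℕ → Γ) (x : unitary B) (N : ℕ) {ε : ℝ} (hε : 0 < ε) :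
    ∃ (e : ℝ → unitary B) (M : ℕ), Continuous e ∧ (∀ t ≤ 0, e t = 1) ∧
      (∀ t, 1 ≤ t → e t = e 1) ∧
      (∀ t, ∀ k ≤ N, ‖(e t : B) * φ (a k) * star (e t : B) - φ (a k)‖ ≤ ε) ∧
      (∀ t, ∀ k ≤ N, ‖β (γ k) (e t) * v (γ k) * star (e t : B) - v (γ k)‖ ≤ ε) ∧
      N < M ∧ ∀ k ≤ N, ∃ j ≤ M,
        ‖b k - ((x * e 1 : unitary B) : B) * φ (a j) * star ((x * e 1 : unitary B) : B)‖ ≤ ε := by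
  have hT : ∀ᶠ t in atTop, ∀ k ≤ N,
      ‖(d t : B) * φ (a k) * star (d t : B) - φ (a k)‖ < ε / 2 ∧
      ‖β (γ k) (d t) * v (γ k) * star (d t : B) - v (γ k)‖ < ε / 2 := by
    refine (Set.finite_Iic N).eventually_all.2 fun k _ => ?_
    have h1 := (tendsto_iff_norm_sub_tendsto_zero.1 (hd.tendsto_conj (a k))).eventually_lt_const
      (half_pos hε)
    have h2 := (tendsto_iff_norm_sub_tendsto_zero.1
      (hd.tendsto_cocycle (γ k))).eventually_lt_const (half_pos hε)
    exact h1.and h2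
  obtain ⟨T, hT⟩ := eventually_atTop.1 (hT.and (eventually_ge_atTop 0))
  set p : unitary B := x * (d T)⁻¹ with hp
  have hS : ∀ᶠ t in atTop, ∀ k ≤ N, ∃ y : A,
      ‖star (d t : B) * (star (p : B) * b k * p) * d t - φ y‖ < ε / 2 := by
    refine (Set.finite_Iic N).eventually_all.2 fun k _ => ?_
    obtain ⟨y, hy⟩ := hd.exists_approx (star (p : B) * b k * p)
    filter_upwards [(tendsto_zero_iff_norm_tendsto_zero.1 hy).eventually_lt_const (half_pos hε)]
      with t ht using ⟨y t, ht⟩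
  obtain ⟨S, hS, hTS⟩ := (hS.and (eventually_ge_atTop T)).exists
  have happrox : ∀ k, ∃ j, k ≤ N →
      ‖star (d S : B) * (star (p : B) * b k * p) * d S - φ (a j)‖ < ε := fun k => by
    by_cases hk : k ≤ N
    · obtain ⟨y, hy⟩ := hS k hk
      obtain ⟨j, hj⟩ := ha.exists_dist_lt y (half_pos hε)
      refine ⟨j, fun _ => ?_⟩
      rw [dist_eq_norm] at hj
      have hle : ‖φ y - φ (a j)‖ < ε / 2 := by
        rw [← map_sub]
        exact (φ.norm_apply_le_of_cstarAlgebra _).trans_lt hj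
      calc _ ≤ _ := norm_sub_le_norm_sub_add_norm_sub _ (φ y) _
        _ < ε := by linarith
    · exact ⟨0, fun h => absurd h hk⟩
  choose j hj using happrox
  let τ : ℝ → ℝ := fun t => T + max 0 (min t 1) * (S - T)
  have hτ : ∀ t, T ≤ τ t := fun t =>
    le_add_of_nonneg_right (mul_nonneg (le_max_left _ _) (sub_nonneg.2 hTS))
  have hτ0 : ∀ t ≤ 0, τ t = T := fun t ht => by
    simp [τ, min_eq_left (ht.trans zero_le_one), max_eq_left ht]
  have hτ1 : ∀ t, 1 ≤ t → τ t = S := fun t ht => by simp [τ, min_eq_right ht]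
  have hT0 : 0 ≤ T := (hT T le_rfl).2
  refine ⟨fun t => (d T)⁻¹ * d (τ t), N + 1 + ∑ k ∈ Finset.range (N + 1), j k, ?_, ?_, ?_, ?_, ?_,
    by omega, ?_⟩
  · refine continuous_const.mul (hd.continuousOn.comp_continuous ?_ fun t => hT0.trans (hτ t))
    fun_prop
  · intro t ht
    simp [hτ0 t ht]
  · intro t ht
    simp [hτ1 t ht, hτ1 1 le_rfl]
  · intro t k hk
    have h1 := ((hT _ (hτ t)).1 k hk).1
    have h2 := ((hT _ le_rfl).1 k hk).1
    rw [← norm_unitary_mul_mul_unitary (d T).2 (Unitary.star_mem (d T).2)]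
    have : (d T : B) * (((d T)⁻¹ * d (τ t) : unitary B) * φ (a k)
        * star (((d T)⁻¹ * d (τ t) : unitary B) : B) - φ (a k)) * star (d T : B)
        = (d (τ t) * φ (a k) * star (d (τ t) : B) - φ (a k))
          - (d T * φ (a k) * star (d T : B) - φ (a k)) := by
      simp only [← Unitary.star_eq_inv, Submonoid.coe_mul, Unitary.coe_star, star_mul, star_star,
        mul_sub, sub_mul, mul_assoc, coe_mul_star_cancel_left, Unitary.mul_star_self_of_mem (d T).2,
        mul_one]
      abel
    rw [this]
    exact (norm_sub_le _ _).trans (by linarith)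
  · intro t k hk
    have h1 := ((hT _ (hτ t)).1 k hk).2
    have h2 := ((hT _ le_rfl).1 k hk).2
    have hβT : β (γ k) (d T) ∈ unitary B := Unitary.map_mem _ (d T).2
    rw [← norm_unitary_mul_mul_unitary hβT (Unitary.star_mem (d T).2)]
    have : β (γ k) (d T) * (β (γ k) ((d T)⁻¹ * d (τ t) : unitary B) * v (γ k)
        * star (((d T)⁻¹ * d (τ t) : unitary B) : B) - v (γ k)) * star (d T : B)
        = (β (γ k) (d (τ t)) * v (γ k) * star (d (τ t) : B) - v (γ k))
          - (β (γ k) (d T) * v (γ k) * star (d T : B) - v (γ k)) := by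
      simp only [← Unitary.star_eq_inv, Submonoid.coe_mul, Unitary.coe_star, star_mul, star_star,
        map_mul, map_star, mul_sub, sub_mul, mul_assoc, mul_star_cancel_left_of_mem_unitary hβT,
        Unitary.mul_star_self_of_mem (d T).2, mul_one]
      abel
    rw [this]
    exact (norm_sub_le _ _).trans (by linarith)
  · intro k hk
    have hmem : k ∈ Finset.range (N + 1) := Finset.mem_range.2 (by omega)
    refine ⟨j k, (Finset.single_le_sum (f := j) (fun _ _ => Nat.zero_le _) hmem).trans
      (by omega), ?_⟩
    simp only [hτ1 1 le_rfl]
    rw [← mul_assoc, ← hp]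
    have hpS := (p * d S).2
    rw [← norm_unitary_mul_mul_unitary (Unitary.star_mem hpS) hpS]
    refine le_of_eq_of_le ?_ (hj k hk).le
    congr 1
    simp only [mul_sub, sub_mul, mul_assoc, Submonoid.coe_mul, star_mul, coe_star_mul_cancel_left,
      Unitary.coe_star_mul_self, mul_one]

theorem exists_limit_path (hd : IsIntertwiningPath β φ v d) {a : ℕ → A} (ha : DenseRange a)
    (b : ℕ → B) (γ : ℕ → Γ) :
    ∃ (X : ℝ → unitary B) (N : ℕ → ℕ), Continuous X ∧ StrictMono N ∧
      (∀ n : ℕ, ∀ t ∈ Set.Icc (n : ℝ) (n + 1), ∀ k ≤ N n,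
        ‖(X t : B) * φ (a k) * star (X t : B) - X n * φ (a k) * star (X n : B)‖
          ≤ 1 / 2 / 2 ^ n) ∧
      (∀ n : ℕ, ∀ t ∈ Set.Icc (n : ℝ) (n + 1), ∀ k ≤ N n,
        ‖β (γ k) (X t) * v (γ k) * star (X t : B)
          - β (γ k) (X n) * v (γ k) * star (X n : B)‖ ≤ 1 / 2 / 2 ^ n) ∧
      ∀ n : ℕ, ∀ k ≤ N n, ∃ j ≤ N (n + 1),
        ‖b k - X (n + 1 : ℕ) * φ (a j) * star (X (n + 1 : ℕ) : B)‖ ≤ 1 / 2 / 2 ^ n := by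
  have hε : ∀ n : ℕ, (0 : ℝ) < 1 / 2 / 2 ^ n := fun n => by positivity
  choose e M he_cont he_zero he_one he_conj he_cocycle hM he_approx using
    fun (x : unitary B) (N n : ℕ) => hd.exists_segment ha b γ x N (hε n)
  let s : ℕ → unitary B × ℕ := fun n =>
    Nat.rec (1, 0) (fun n p => (p.1 * e p.1 p.2 n 1, M p.1 p.2 n)) n
  let f : ℕ → ℝ → unitary B := fun n t => e (s n).1 (s n).2 n (t - n)
  let P : ℕ → ℝ → unitary B := fun n t => Nat.rec 1 (fun n p => p * f n t) n
  have hP_succ : ∀ n t, P (n + 1) t = P n t * f n t := fun _ _ => rfl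
  have hs_succ : ∀ n, (s (n + 1)).1 = (s n).1 * e (s n).1 (s n).2 n 1 := fun _ => rfl
  have hP_cont : ∀ n, Continuous (P n) := fun n => by
    induction n with
    | zero => exact continuous_const
    | succ n ih =>
      exact ih.mul ((he_cont _ _ _).comp (continuous_id.sub continuous_const))
  have hP_stable : ∀ (n m : ℕ) (t : ℝ), t ≤ n → n ≤ m → P m t = P n t := fun n m t ht hnm => by
    induction m, hnm using Nat.le_induction with
    | base => rfl
    | succ m hm ih =>
      have : (n : ℝ) ≤ m := by exact_mod_cast hm
      rw [hP_succ, ih]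
      simp only [f]
      rw [he_zero _ _ _ _ (by linarith), mul_one]
  have hP_eq : ∀ (n : ℕ) (t : ℝ), n ≤ t → P n t = (s n).1 := fun n => by
    induction n with
    | zero => exact fun _ _ => rfl
    | succ n ih =>
      intro t ht
      push_cast at ht
      rw [hP_succ, ih t (by linarith), hs_succ]
      simp only [f]
      rw [he_one _ _ _ _ (by linarith)]
  let X : ℝ → unitary B := fun t => P ⌈t⌉₊ t
  have hX : ∀ (n : ℕ) (t : ℝ), t ≤ n → X t = P n t := fun n t ht =>
    (hP_stable _ n t (Nat.le_ceil t) (Nat.ceil_le.2 ht)).symm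
  have hX_nat : ∀ n : ℕ, X n = (s n).1 := fun n => by rw [hX n n le_rfl, hP_eq n n le_rfl]
  have hX_Icc : ∀ n : ℕ, ∀ t ∈ Set.Icc (n : ℝ) (n + 1), X t = X n * f n t := fun n t ht => by
    rw [hX (n + 1) t (by exact_mod_cast ht.2), hP_succ, hP_eq n t ht.1, hX_nat]
  refine ⟨X, fun n => (s n).2, ?_, strictMono_nat_of_lt_succ fun n => hM _ _ _, ?_, ?_, ?_⟩
  · refine continuous_iff_continuousAt.2 fun t => ?_
    obtain ⟨n, hn⟩ := exists_nat_gt t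
    refine (hP_cont n).continuousAt.congr ?_
    filter_upwards [Iio_mem_nhds hn] with r hr using (hX n r (le_of_lt hr)).symm
  · intro n t ht k hk
    refine le_of_eq_of_le ?_ (he_conj (s n).1 (s n).2 n (t - n) k hk)
    rw [← norm_unitary_mul_mul_unitary (X n).2 (Unitary.star_mem (X n).2) (_ - φ (a k)),
      hX_Icc n t ht]
    congr 1
    simp only [f, mul_sub, sub_mul, mul_assoc, Submonoid.coe_mul, star_mul]
  · intro n t ht k hk
    refine le_of_eq_of_le ?_ (he_cocycle (s n).1 (s n).2 n (t - n) k hk)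
    rw [← norm_unitary_mul_mul_unitary (Unitary.map_mem (β (γ k)) (X n).2)
      (Unitary.star_mem (X n).2) (_ - (v (γ k) : B)), hX_Icc n t ht]
    congr 1
    simp only [f, mul_sub, sub_mul, mul_assoc, Submonoid.coe_mul, star_mul, map_mul]
  · intro n k hk
    obtain ⟨j, hj, h⟩ := he_approx (s n).1 (s n).2 n k hk
    refine ⟨j, hj, ?_⟩
    rw [hX_nat, hs_succ]
    exact h

end IsIntertwiningPath

/-- The pointwise limit of inner perturbations of an isometric unital homomorphism is an isometric
unital homomorphism. -/
theorem exists_starAlgHom_of_tendsto_conj {A B : Type*} [CStarAlgebra A] [CStarAlgebra B]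
    (φ : A →⋆ₐ[ℂ] B) (hφ : ∀ a, ‖φ a‖ = ‖a‖) {X : ℝ → unitary B} {a : ℕ → A}
    (ha : DenseRange a)
    (h : ∀ k, ∃ y, Tendsto (fun t => (X t : B) * φ (a k) * star (X t : B)) atTop (𝓝 y)) :
    ∃ Φ : A →⋆ₐ[ℂ] B, (∀ x, ‖Φ x‖ = ‖x‖) ∧
      ∀ x, Tendsto (fun t => (X t : B) * φ x * star (X t : B)) atTop (𝓝 (Φ x)) := by
  have hlim : ∀ x, ∃ y, Tendsto (fun t => (X t : B) * φ x * star (X t : B)) atTop (𝓝 y) := by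
    intro x
    rw [← cauchy_map_iff_exists_tendsto, Metric.cauchy_iff]
    refine ⟨inferInstance, fun ε hε => ?_⟩
    obtain ⟨k, hk⟩ := ha.exists_dist_lt x (show 0 < ε / 4 by positivity)
    obtain ⟨y, hy⟩ := h k
    refine ⟨Metric.ball y (ε / 2), ?_, fun p hp q hq => ?_⟩
    · rw [mem_map]
      filter_upwards [hy.eventually (Metric.ball_mem_nhds y (show 0 < ε / 4 by positivity))] with t ht
      rw [Set.mem_preimage, Metric.mem_ball] at *
      refine (dist_triangle _ ((X t : B) * φ (a k) * star (X t : B)) _).trans_lt ?_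
      have : dist ((X t : B) * φ x * star (X t : B)) ((X t : B) * φ (a k) * star (X t : B))
          = dist x (a k) := by
        rw [dist_eq_norm, dist_eq_norm, ← sub_mul, ← mul_sub, ← map_sub,
          norm_unitary_mul_mul_unitary (X t).2 (Unitary.star_mem (X t).2), hφ]
      rw [this]
      linarith
    · have := dist_triangle_right p q y
      rw [Metric.mem_ball] at hp hq
      linarith
  choose Φ hΦ using hlim
  refine ⟨{ toFun := Φ
            map_one' := ?_
            map_mul' := fun x y => ?_
            map_zero' := ?_
            map_add' := fun x y => ?_
            commutes' := fun c => ?_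
            map_star' := fun x => ?_ }, fun x => ?_, hΦ⟩
  · exact tendsto_nhds_unique (hΦ 1) (tendsto_const_nhds.congr fun t => by simp)
  · refine tendsto_nhds_unique (hΦ (x * y)) (((hΦ x).mul (hΦ y)).congr fun t => ?_)
    simp only [map_mul, mul_assoc, coe_star_mul_cancel_left]
  · exact tendsto_nhds_unique (hΦ 0) (tendsto_const_nhds.congr fun t => by simp)
  · refine tendsto_nhds_unique (hΦ (x + y)) (((hΦ x).add (hΦ y)).congr fun t => ?_)
    simp only [map_add, mul_add, add_mul]
  · refine tendsto_nhds_unique (hΦ (algebraMap ℂ A c)) (tendsto_const_nhds.congr fun t => ?_)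
    rw [AlgHomClass.commutes, ← Algebra.commutes, mul_assoc,
      Unitary.mul_star_self_of_mem (X t).2, mul_one]
  · refine tendsto_nhds_unique (hΦ (star x)) ((hΦ x).star.congr fun t => ?_)
    simp only [star_mul, star_star, map_star, mul_assoc]
  · refine tendsto_nhds_unique (hΦ x).norm (tendsto_const_nhds.congr fun t => ?_)
    rw [norm_unitary_mul_mul_unitary (X t).2 (Unitary.star_mem (X t).2), hφ]

/-- The pointwise limit of inner perturbations of a cocycle morphism is a cocycle morphism. -/
theorem IsCocyclePair.of_tendsto {Γ A B : Type*} [Group Γ] [CStarAlgebra A] [CStarAlgebra B]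
    {α : Γ → A ≃⋆ₐ[ℂ] A} {β : Γ → B ≃⋆ₐ[ℂ] B} (hβ : IsCStarAction β)
    {φ Φ : A → B} {v V : Γ → unitary B} (h : IsCocyclePair α β φ v) {X : ℝ → unitary B}
    (hΦ : ∀ a, Tendsto (fun t => (X t : B) * φ a * star (X t : B)) atTop (𝓝 (Φ a)))
    (hV : ∀ g, Tendsto (fun t => β g (X t) * v g * star (X t : B)) atTop (𝓝 (V g : B))) :
    IsCocyclePair α β Φ V := by
  obtain ⟨hv1, hv2, hv3⟩ := h
  have hβX : ∀ g t, β g (star (X t : B)) * β g (X t) = 1 := fun g t => by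
    rw [← map_mul, Unitary.coe_star_mul_self, map_one]
  have hβX' : ∀ g t (y : B), β g (star (X t : B)) * (β g (X t) * y) = y := fun g t y => by
    rw [← mul_assoc, hβX, one_mul]
  refine ⟨Subtype.ext ?_, fun g a => ?_, fun g h => ?_⟩
  · refine tendsto_nhds_unique (hV 1) (tendsto_const_nhds.congr fun t => ?_)
    simp [hv1, hβ.1]
  · refine tendsto_nhds_unique
      ((((β g).continuous_of_cstarAlgebra.tendsto _).comp (hΦ a)).mul (hV g))
      (((hV g).mul (hΦ (α g a))).congr fun t => ?_)
    simp only [Function.comp, map_mul, mul_assoc, coe_star_mul_cancel_left, hβX']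
    rw [← mul_assoc (v g : B), ← hv2, mul_assoc]
  · refine tendsto_nhds_unique (hV (g * h))
      (((((β g).continuous_of_cstarAlgebra.tendsto _).comp (hV h)).mul (hV g)).congr fun t => ?_)
    simp only [Function.comp, map_mul, mul_assoc, hβX', hv3, hβ.2]

/-- One-sided asymptotic intertwining. -/
theorem IsIntertwiningPath.exists_cocycleConjugacy {Γ A B : Type*} [Group Γ] [Countable Γ]
    [CStarAlgebra A] [CStarAlgebra B]
    [TopologicalSpace.SeparableSpace A] [TopologicalSpace.SeparableSpace B]
    {α : Γ → A ≃⋆ₐ[ℂ] A} {β : Γ → B ≃⋆ₐ[ℂ] B} (hβ : IsCStarAction β)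
    {φ : A →⋆ₐ[ℂ] B} (hφ : ∀ a, ‖φ a‖ = ‖a‖) {v : Γ → unitary B}
    (hφv : IsCocyclePair α β φ v) {d : ℝ → unitary B} (hd : IsIntertwiningPath β φ v d) :
    ∃ (Φ : A ≃⋆ₐ[ℂ] B) (V : Γ → unitary B) (X : ℝ → unitary B),
      IsCocyclePair α β Φ V ∧ Continuous X ∧
      (∀ a, Tendsto (fun t => (X t : B) * φ a * star (X t : B)) atTop (𝓝 (Φ a))) ∧
      ∀ g, Tendsto (fun t => β g (X t) * v g * star (X t : B)) atTop (𝓝 (V g : B)) := by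
  obtain ⟨γ, hγ⟩ := exists_surjective_nat Γ
  have ha := TopologicalSpace.denseRange_denseSeq A
  have hb := TopologicalSpace.denseRange_denseSeq B
  set a := TopologicalSpace.denseSeq A
  set b := TopologicalSpace.denseSeq B
  obtain ⟨X, N, hX, hN, hconj, hcocycle, happrox⟩ := hd.exists_limit_path ha b γ
  choose y hy _ using fun k => exists_tendsto_of_norm_sub_le_geometric
    (fun t => (X t : B) * φ (a k) * star (X t : B)) k
    fun n hn t ht => hconj n t ht k (hn.trans (hN.id_le n))
  have hVlim : ∀ g, ∃ V : B,
      Tendsto (fun t => β g (X t) * v g * star (X t : B)) atTop (𝓝 V) := fun g => by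
    obtain ⟨k, rfl⟩ := hγ g
    obtain ⟨V, hV, -⟩ := exists_tendsto_of_norm_sub_le_geometric
      (fun t => β (γ k) (X t) * v (γ k) * star (X t : B)) k
      fun n hn t ht => hcocycle n t ht k (hn.trans (hN.id_le n))
    exact ⟨V, hV⟩
  choose V hV using hVlim
  have hVmem : ∀ g, V g ∈ unitary B := fun g =>
    isClosed_unitary.mem_of_tendsto (hV g) (Eventually.of_forall fun t =>
      mul_mem (mul_mem (Unitary.map_mem _ (X t).2) (v g).2) (Unitary.star_mem (X t).2))
  obtain ⟨Φ, hΦnorm, hΦ⟩ := exists_starAlgHom_of_tendsto_conj φ hφ ha fun k => ⟨y k, hy k⟩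
  have hΦiso : Isometry Φ := AddMonoidHomClass.isometry_of_norm Φ hΦnorm
  have hrange : ∀ k, b k ∈ closure (Set.range Φ) := fun k => by
    rw [Metric.mem_closure_range_iff]
    intro ε hε
    obtain ⟨n, hn⟩ := (((tendsto_pow_atTop_nhds_zero_of_lt_one (r := (1 / 2 : ℝ)) (by norm_num)
      (by norm_num)).eventually_lt_const hε).and (eventually_ge_atTop k)).exists
    obtain ⟨j, hj, hjn⟩ := happrox n k (hn.2.trans (hN.id_le n))
    obtain ⟨x, hx, hx'⟩ := exists_tendsto_of_norm_sub_le_geometric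
      (fun t => (X t : B) * φ (a j) * star (X t : B)) (n + 1)
      fun i hi t ht => hconj i t ht j (hj.trans (hN.monotone hi))
    obtain rfl := tendsto_nhds_unique hx (hΦ (a j))
    refine ⟨a j, ?_⟩
    rw [dist_eq_norm]
    refine ((norm_sub_le_norm_sub_add_norm_sub _ _ _).trans
      (add_le_add hjn (hx' (n + 1) le_rfl))).trans_lt (lt_of_eq_of_lt ?_ hn.1)
    rw [one_div_pow, pow_succ]
    field_simp
    norm_num
  have hsurj : Function.Surjective Φ := by
    rw [← Set.range_eq_univ, ← hΦiso.isClosedEmbedding.isClosed_range.closure_eq]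
    refine Dense.closure_eq ?_
    rw [← dense_closure]
    exact hb.mono (Set.range_subset_iff.2 hrange)
  refine ⟨StarAlgEquiv.ofBijective Φ ⟨hΦiso.injective, hsurj⟩, fun g => ⟨V g, hVmem g⟩, X, ?_, hX,
    hΦ, hV⟩
  exact hφv.of_tendsto hβ hΦ hV

/-- From unitary paths implementing `ψ ∘ φ ∼ id` and `φ ∘ ψ ∼ id` one obtains an intertwining path
for `φ`. -/
theorem IsIntertwiningPath.of_asymptotic_inverse {Γ A B : Type*} [Group Γ] [CStarAlgebra A]
    [CStarAlgebra B] {α : Γ → A ≃⋆ₐ[ℂ] A} {β : Γ → B ≃⋆ₐ[ℂ] B}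
    {φ : A →⋆ₐ[ℂ] B} {v : Γ → unitary B} (hφv : IsCocyclePair α β φ v)
    {ψ : B →⋆ₐ[ℂ] A} {w : Γ → unitary A} {u : ℝ → unitary A} {z : ℝ → unitary B}
    (hu : ContinuousOn u (Set.Ici (0 : ℝ))) (hz : ContinuousOn z (Set.Ici (0 : ℝ)))
    (hu_conj : ∀ a, Tendsto (fun t => (u t : A) * ψ (φ a) * star (u t : A)) atTop (𝓝 a))
    (hu_cocycle : ∀ g, Tendsto (fun t => α g (u t) * (w g * ψ (v g)) * star (u t : A)) atTop
      (𝓝 1))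
    (hz_conj : ∀ b, Tendsto (fun t => (z t : B) * φ (ψ b) * star (z t : B)) atTop (𝓝 b))
    (hz_cocycle : ∀ g, Tendsto (fun t => β g (z t) * (v g * φ (w g)) * star (z t : B)) atTop
      (𝓝 1)) :
    IsIntertwiningPath β φ v
      fun t => z t * ⟨φ (star (u t : A)), Unitary.map_mem φ (Unitary.star_mem (u t).2)⟩ := by
  have hu_mem : ∀ t, (u t : A) ∈ unitary A := fun t => (u t).2
  have hu_star : ∀ t, star (u t : A) ∈ unitary A := fun t => Unitary.star_mem (u t).2
  have hz_mem : ∀ t, (z t : B) ∈ unitary B := fun t => (z t).2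
  have hz_star : ∀ t, star (z t : B) ∈ unitary B := fun t => Unitary.star_mem (z t).2
  refine ⟨?_, fun a => ?_, fun g => ?_, fun b => ⟨fun t => u t * ψ b * star (u t : A), ?_⟩⟩
  · refine hz.mul (Topology.IsInducing.subtypeVal.continuousOn_iff.2 ?_)
    exact φ.continuous_of_cstarAlgebra.comp_continuousOn
      (continuous_subtype_val.comp_continuousOn hu).star
  · have h1 : Tendsto (fun t => φ (star (u t : A) * a * u t)) atTop (𝓝 (φ (ψ (φ a)))) := by
      have := tendsto_star_mul_mul_star hu_mem hu_star (hu_conj a)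
      simp only [star_star] at this
      exact (φ.continuous_of_cstarAlgebra.tendsto _).comp this
    refine (tendsto_unitary_mul_mul_unitary hz_mem hz_star h1 (hz_conj (φ a))).congr fun t => ?_
    simp only [Submonoid.coe_mul, map_mul, map_star, star_mul, star_star, mul_assoc]
  · have h1 : Tendsto (fun t => v g * φ (star (α g (u t : A)) * u t)) atTop
        (𝓝 (v g * φ (w g * ψ (v g)))) := by
      have := tendsto_star_mul_mul_star (fun t => Unitary.map_mem (α g) (hu_mem t)) hu_star
        (hu_cocycle g)
      simp only [star_star, mul_one] at this
      exact ((φ.continuous_of_cstarAlgebra.tendsto _).comp this).const_mul _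
    have h2 : Tendsto (fun t => β g (z t) * (v g * φ (w g * ψ (v g))) * star (z t : B)) atTop
        (𝓝 (v g : B)) := by
      have := (hz_cocycle g).mul (hz_conj (v g))
      rw [one_mul] at this
      refine this.congr fun t => ?_
      simp only [map_mul, mul_assoc, coe_star_mul_cancel_left]
    refine (tendsto_unitary_mul_mul_unitary (fun t => Unitary.map_mem (β g) (hz_mem t)) hz_star
      h1 h2).congr fun t => ?_
    rw [map_mul, ← map_star (α g), ← mul_assoc (v g : B), ← hφv.2.1]
    simp only [Submonoid.coe_mul, map_mul, map_star, star_mul, star_star, mul_assoc]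
  · have h1 := tendsto_star_mul_mul_star hz_mem hz_star (hz_conj b)
    simp only [star_star] at h1
    rw [tendsto_iff_norm_sub_tendsto_zero] at h1
    rw [tendsto_zero_iff_norm_tendsto_zero]
    refine h1.congr fun t => ?_
    rw [← norm_unitary_mul_mul_unitary (Unitary.map_mem φ (hu_mem t))
      (Unitary.map_mem φ (hu_star t))]
    congr 1
    simp only [Submonoid.coe_mul, map_mul, map_star, star_mul, star_star, mul_assoc, mul_sub,
      sub_mul]

/-- If `ψ ∘ φ ∼ id`, then a cocycle conjugacy that is a limit of inner perturbations of `φ` has an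
inverse asymptotically unitarily equivalent to `ψ`. -/
theorem CocycleAsympUnitaryEquiv.symm_of_asymptotic_left_inverse {Γ A B : Type*} [Group Γ]
    [CStarAlgebra A] [CStarAlgebra B] {α : Γ → A ≃⋆ₐ[ℂ] A} {β : Γ → B ≃⋆ₐ[ℂ] B}
    {φ : A →⋆ₐ[ℂ] B} {v : Γ → unitary B}
    {ψ : B →⋆ₐ[ℂ] A} {w : Γ → unitary A} (hψw : IsCocyclePair β α ψ w) {u : ℝ → unitary A}
    (hu : ContinuousOn u (Set.Ici (0 : ℝ)))
    (hu_conj : ∀ a, Tendsto (fun t => (u t : A) * ψ (φ a) * star (u t : A)) atTop (𝓝 a))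
    (hu_cocycle : ∀ g, Tendsto (fun t => α g (u t) * (w g * ψ (v g)) * star (u t : A)) atTop
      (𝓝 1))
    {Φ : A ≃⋆ₐ[ℂ] B} {V : Γ → unitary B} {X : ℝ → unitary B} (hX : Continuous X)
    (hΦ : ∀ a, Tendsto (fun t => (X t : B) * φ a * star (X t : B)) atTop (𝓝 (Φ a)))
    (hV : ∀ g, Tendsto (fun t => β g (X t) * v g * star (X t : B)) atTop (𝓝 (V g : B))) :
    CocycleAsympUnitaryEquiv α Φ.symm ψ (fun g => star (Φ.symm (V g))) (fun g => (w g : A)) := by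
  have hu_mem : ∀ t, (u t : A) ∈ unitary A := fun t => (u t).2
  have hu_star : ∀ t, star (u t : A) ∈ unitary A := fun t => Unitary.star_mem (u t).2
  have hψX : ∀ t, ψ (X t : B) ∈ unitary A := fun t => Unitary.map_mem ψ (X t).2
  have hψX_star : ∀ t, ψ (star (X t : B)) ∈ unitary A := fun t =>
    Unitary.map_mem ψ (Unitary.star_mem (X t).2)
  have hconj : ∀ a, Tendsto (fun t => star (u t : A) * a * u t) atTop (𝓝 (ψ (φ a))) := fun a => by
    simpa only [star_star] using tendsto_star_mul_mul_star hu_mem hu_star (hu_conj a)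
  refine CocycleAsympUnitaryEquiv.of_path (fun t => ⟨ψ (X t), hψX t⟩ * star (u t)) ?_
    (fun b => ?_) fun g => ?_
  · refine ContinuousOn.mul (Continuous.continuousOn ?_) hu.star
    exact (ψ.continuous_of_cstarAlgebra.comp (continuous_subtype_val.comp hX)).subtype_mk _
  · have h1 : Tendsto (fun t => ψ (X t) * ψ (φ (Φ.symm b)) * ψ (star (X t : B))) atTop
        (𝓝 (ψ b)) := by
      have := (ψ.continuous_of_cstarAlgebra.tendsto _).comp (hΦ (Φ.symm b))
      rw [StarAlgEquiv.apply_symm_apply] at this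
      exact this.congr fun t => by simp only [Function.comp, map_mul]
    refine (tendsto_unitary_mul_mul_unitary hψX hψX_star (hconj (Φ.symm b)) h1).congr fun t => ?_
    simp only [Submonoid.coe_mul, Unitary.coe_star, map_star, star_mul, star_star, mul_assoc]
  · set W : A := star (Φ.symm (V g)) with hW
    have hΦW : (V g : B) * Φ W = 1 := by
      rw [hW, map_star, StarAlgEquiv.apply_symm_apply, Unitary.mul_star_self_of_mem (V g).2]
    have h1 : Tendsto (fun t => star (α g (u t : A)) * W * u t) atTop
        (𝓝 (w g * ψ (v g) * ψ (φ W))) := by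
      have := tendsto_star_mul_mul_star (fun t => Unitary.map_mem (α g) (hu_mem t)) hu_star
        (hu_cocycle g)
      refine (this.mul (hconj W)).congr fun t => ?_
      simp only [star_star, mul_one, mul_assoc, coe_mul_star_cancel_left]
    have h2 : Tendsto (fun t => α g (ψ (X t)) * (w g * ψ (v g) * ψ (φ W)) * ψ (star (X t : B)))
        atTop (𝓝 (w g : A)) := by
      have := (((ψ.continuous_of_cstarAlgebra.tendsto _).comp
        ((hV g).mul (hΦ W)))).const_mul (w g : A)
      rw [hΦW, map_one, mul_one] at this
      refine this.congr fun t => ?_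
      simp only [Function.comp, mul_assoc, coe_star_mul_cancel_left, map_mul]
      rw [← mul_assoc (w g : A), ← hψw.2.1, mul_assoc]
    refine (tendsto_unitary_mul_mul_unitary (fun t => Unitary.map_mem (α g) (hψX t)) hψX_star h1
      h2).congr fun t => ?_
    simp only [Submonoid.coe_mul, Unitary.coe_star, map_mul, map_star, star_mul, star_star,
      mul_assoc]

/-- An asymptotic left inverse is unital. -/
theorem asymptotic_left_inverse_map_one {Γ A B : Type*} [Group Γ] [CStarAlgebra A]
    [CStarAlgebra B] {α : Γ → A ≃⋆ₐ[ℂ] A} (hα : IsCStarAction α)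
    {φ : A →⋆ₙₐ[ℂ] B} {v : Γ → unitary B} (hv : v 1 = 1)
    {ψ : B →⋆ₙₐ[ℂ] A} {w : Γ → unitary A} (hw : w 1 = 1)
    (h : CocycleAsympUnitaryEquiv α (fun a => ψ (φ a)) (id : A → A)
      (fun g => (w g : A) * ψ (v g)) (fun _ => (1 : A))) :
    ψ 1 = 1 := by
  obtain ⟨u, -, h⟩ := h
  have h1 := h 1 1
  have h2 : (fun t => ‖α 1 (u t) * ((w 1 : A) * ψ (v 1)) * ψ (φ 1) * star (u t : A) - 1 * id 1‖)
      = fun _ => ‖ψ (φ 1) - 1‖ := by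
    funext t
    rw [← norm_unitary_mul_mul_unitary (u t).2 (Unitary.star_mem (u t).2) (ψ (φ 1) - 1)]
    congr 1
    simp only [hv, hw, hα.1, OneMemClass.coe_one, one_mul, id_eq, mul_sub, sub_mul, mul_one,
      Unitary.mul_star_self_of_mem (u t).2, mul_assoc]
    rw [← mul_assoc (ψ 1), ← map_mul, one_mul]
  rw [h2, tendsto_const_nhds_iff, norm_eq_zero, sub_eq_zero] at h1
  calc ψ 1 = ψ 1 * ψ (φ 1) := by rw [h1, mul_one]
    _ = 1 := by rw [← map_mul, one_mul, h1]

/-- A unit-preserving non-unital star homomorphism as a unital one. -/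
noncomputable def unitalStarAlgHom {A B : Type*} [CStarAlgebra A] [CStarAlgebra B] (φ : A →⋆ₙₐ[ℂ] B)
    (h : φ 1 = 1) : A →⋆ₐ[ℂ] B where
  toFun := φ
  map_one' := h
  map_mul' := map_mul φ
  map_zero' := map_zero φ
  map_add' := map_add φ
  commutes' c := by rw [Algebra.algebraMap_eq_smul_one, map_smul, h, Algebra.algebraMap_eq_smul_one]
  map_star' := map_star φ

/-- Asymptotic two-sided Elliott intertwining for cocycle morphisms of group
actions: if `(ψ, w) ∘ (φ, v)` and `(φ, v) ∘ (ψ, w)` are asymptotically unitarily equivalent to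
the respective identity cocycle morphisms, then there is a cocycle conjugacy `(Φ, V)`
asymptotically unitarily equivalent to `(φ, v)` whose inverse is asymptotically unitarily
equivalent to `(ψ, w)`. -/
theorem stmt2 {Γ A B : Type*} [Group Γ] [Countable Γ]
    [CStarAlgebra A] [CStarAlgebra B]
    [TopologicalSpace.SeparableSpace A] [TopologicalSpace.SeparableSpace B]
    (α : Γ → A ≃⋆ₐ[ℂ] A) (β : Γ → B ≃⋆ₐ[ℂ] B)
    (hα : IsCStarAction α) (hβ : IsCStarAction β)
    (φ : A →⋆ₙₐ[ℂ] B) (v : Γ → unitary B) (hφv : IsCocyclePair α β (⇑φ) v)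
    (ψ : B →⋆ₙₐ[ℂ] A) (w : Γ → unitary A) (hψw : IsCocyclePair β α (⇑ψ) w)
    (h1 : CocycleAsympUnitaryEquiv α (fun a => ψ (φ a)) (id : A → A)
      (fun g => (w g : A) * ψ (v g)) (fun _ => (1 : A)))
    (h2 : CocycleAsympUnitaryEquiv β (fun b => φ (ψ b)) (id : B → B)
      (fun g => (v g : B) * φ (w g)) (fun _ => (1 : B))) :
    ∃ (Φ : A ≃⋆ₐ[ℂ] B) (V : Γ → unitary B),
      IsCocyclePair α β (⇑Φ) V ∧
      CocycleAsympUnitaryEquiv β (⇑Φ) (⇑φ) (fun g => (V g : B)) (fun g => (v g : B)) ∧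
      CocycleAsympUnitaryEquiv α (⇑Φ.symm) (⇑ψ)
        (fun g => star (Φ.symm (V g))) (fun g => (w g : A)) := by
  have hψ1 : ψ 1 = 1 := asymptotic_left_inverse_map_one hα hφv.1 hψw.1 h1
  have hφ1 : φ 1 = 1 := asymptotic_left_inverse_map_one hβ hψw.1 hφv.1 h2
  obtain ⟨u, hu, hu_conj, hu_cocycle⟩ := h1.exists_path hα
    (by simp [hφv.1, hψw.1, hψ1]) rfl (by simp [hφ1, hψ1]) rfl
  obtain ⟨z, hz, hz_conj, hz_cocycle⟩ := h2.exists_path hβ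
    (by simp [hφv.1, hψw.1, hφ1]) rfl (by simp [hφ1, hψ1]) rfl
  let φ' := unitalStarAlgHom φ hφ1
  let ψ' := unitalStarAlgHom ψ hψ1
  have hφ_norm : ∀ a, ‖φ' a‖ = ‖a‖ := fun a => by
    refine le_antisymm (φ'.norm_apply_le_of_cstarAlgebra a) ?_
    have h : ‖ψ (φ a)‖ = ‖a‖ := by
      refine tendsto_nhds_unique (tendsto_const_nhds.congr fun t => ?_) (hu_conj a).norm
      rw [norm_unitary_mul_mul_unitary (u t).2 (Unitary.star_mem (u t).2)]
    exact h ▸ ψ'.norm_apply_le_of_cstarAlgebra (φ a)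
  have hd : IsIntertwiningPath β φ' v _ := IsIntertwiningPath.of_asymptotic_inverse (ψ := ψ') hφv
    hu hz hu_conj hu_cocycle hz_conj hz_cocycle
  obtain ⟨Φ, V, X, hΦV, hX, hΦ, hV⟩ := hd.exists_cocycleConjugacy hβ hφ_norm hφv
  refine ⟨Φ, V, hΦV, ?_, CocycleAsympUnitaryEquiv.symm_of_asymptotic_left_inverse (φ := φ')
    (ψ := ψ') hψw hu hu_conj hu_cocycle hX hΦ hV⟩
  have hX_mem : ∀ t, (X t : B) ∈ unitary B := fun t => (X t).2
  have hX_star : ∀ t, star (X t : B) ∈ unitary B := fun t => Unitary.star_mem (X t).2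
  refine CocycleAsympUnitaryEquiv.of_path (fun t => star (X t)) hX.star.continuousOn
    (fun a => tendsto_star_mul_mul_star hX_mem hX_star (hΦ a)) fun g => ?_
  refine (tendsto_star_mul_mul_star (fun t => Unitary.map_mem (β g) (hX_mem t)) hX_star
    (hV g)).congr fun t => ?_
  simp only [Unitary.coe_star, map_star]
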